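/- Let s > d/2, let f(x,u) be as in the composition operator setting (continuous, analytic in u, H^s-smooth in x, with ‖f(·,u)‖_s ≤ C(R) on |u| < R), and suppose f is real for real arguments. Then u ↦ f(·, u(·)) defines a real-analytic map from the real Sobolev space H^s(𝕋^d;ℝ) into itself. -/

import Mathlib

open scoped BigOperators
open MeasureTheory Set Filter

noncomputable section

/-- The `k`-th Fourier coefficient of a function on the torus `𝕋^d = ℝ^d/ℤ^d`
(represented by a `ℤ^d`-periodic function on `ℝ^d`). -/
def tcoeff {d : ℕ} (u : (Fin d → ℝ) → ℂ) (k : Fin d → ℤ) : ℂ :=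
  ∫ x in Set.univ.pi (fun _ : Fin d => Set.Ico (0 : ℝ) 1),
    u x * Complex.exp (-2 * Real.pi * Complex.I * (∑ i, (k i : ℂ) * (x i : ℂ)))

/-- The Sobolev weight `(1 + |k|²)^s`. -/
def sobWeight {d : ℕ} (s : ℝ) (k : Fin d → ℤ) : ℝ :=
  (1 + ∑ i, ((k i : ℝ)) ^ 2) ^ s

/-- Square of the Sobolev `H^s`-norm, via Fourier coefficients. -/
def sobNormSq {d : ℕ} (s : ℝ) (u : (Fin d → ℝ) → ℂ) : ℝ :=
  ∑' k : Fin d → ℤ, sobWeight s k * ‖tcoeff u k‖ ^ 2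

/-- The Sobolev `H^s`-norm on the torus. -/
def sobNorm {d : ℕ} (s : ℝ) (u : (Fin d → ℝ) → ℂ) : ℝ :=
  Real.sqrt (sobNormSq s u)

/-- `ℤ^d`-periodicity: the function lives on the torus `𝕋^d`. -/
def ZPeriodic {d : ℕ} {α : Type*} (u : (Fin d → ℝ) → α) : Prop :=
  ∀ (x : Fin d → ℝ) (i : Fin d), u (x + Pi.single i 1) = u x

/-- Membership in the Sobolev space `H^s(𝕋^d; ℂ)`. -/
def MemHs {d : ℕ} (s : ℝ) (u : (Fin d → ℝ) → ℂ) : Prop :=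
  ZPeriodic u ∧ Summable (fun k : Fin d → ℤ => sobWeight s k * ‖tcoeff u k‖ ^ 2)

/-- Membership in the real Sobolev space `H^s(𝕋^d; ℝ)`. -/
def MemHsR {d : ℕ} (s : ℝ) (u : (Fin d → ℝ) → ℝ) : Prop :=
  MemHs s fun x => (u x : ℂ)

/-- `H^s`-norm of a real-valued function. -/
def sobNormR {d : ℕ} (s : ℝ) (u : (Fin d → ℝ) → ℝ) : ℝ :=
  sobNorm s fun x => (u x : ℂ)

end

noncomputable section

namespace HsTorus

variable {d : ℕ}

/-! ### The Sobolev weight -/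

lemma sobWeight_base_pos (k : Fin d → ℤ) : 0 < 1 + ∑ i, ((k i : ℝ)) ^ 2 := by positivity

lemma sobWeight_pos (s : ℝ) (k : Fin d → ℤ) : 0 < sobWeight s k :=
  Real.rpow_pos_of_pos (sobWeight_base_pos k) s

lemma sobWeight_neg (s : ℝ) (k : Fin d → ℤ) : sobWeight s (-k) = sobWeight s k := by
  simp [sobWeight]

lemma sobWeight_add_le {s : ℝ} (hs : 0 ≤ s) (j k : Fin d → ℤ) :
    sobWeight s (j + k) ≤ 4 ^ s * (sobWeight s j + sobWeight s k) := by
  have key : ∀ a b : Fin d → ℤ, (∑ i, ((a i : ℝ)) ^ 2) ≤ ∑ i, ((b i : ℝ)) ^ 2 →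
      sobWeight s (a + b) ≤ 4 ^ s * sobWeight s b := by
    intro a b hab
    unfold sobWeight
    rw [← Real.mul_rpow (by norm_num) (sobWeight_base_pos b).le]
    refine Real.rpow_le_rpow (sobWeight_base_pos _).le ?_ hs
    have : ∑ i, (((a + b) i : ℤ) : ℝ) ^ 2
        ≤ ∑ i, (2 * ((a i : ℝ)) ^ 2 + 2 * ((b i : ℝ)) ^ 2) := by
      refine Finset.sum_le_sum fun i _ => ?_
      push_cast [Pi.add_apply]
      nlinarith [sq_nonneg ((a i : ℝ) - b i)]
    rw [Finset.sum_add_distrib, ← Finset.mul_sum, ← Finset.mul_sum] at this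
    linarith
  have h4 : (0 : ℝ) ≤ 4 ^ s := by positivity
  rcases le_total (∑ i, ((j i : ℝ)) ^ 2) (∑ i, ((k i : ℝ)) ^ 2) with h | h
  · exact (key j k h).trans
      (mul_le_mul_of_nonneg_left (le_add_of_nonneg_left (sobWeight_pos s j).le) h4)
  · rw [add_comm j k]
    exact (key k j h).trans
      (mul_le_mul_of_nonneg_left (le_add_of_nonneg_right (sobWeight_pos s k).le) h4)

lemma summable_norm_intCast_rpow {r : ℝ} (hr : r < -d) :
    Summable fun k : Fin d → ℤ => ‖(fun i => (k i : ℝ))‖ ^ r := by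
  let b := Pi.basisFun ℝ (Fin d)
  let L := Submodule.span ℤ (Set.range b)
  have hfin : Module.finrank ℤ L ≤ d := by
    simpa [Set.finrank] using finrank_range_le_card (R := ℤ) (b := b)
  have hsum : Summable fun z : L => ‖z‖ ^ r :=
    ZLattice.summable_norm_rpow L r (hr.trans_le (by simpa using hfin))
  let φ : (Fin d → ℤ) → L := fun k => ⟨fun i => (k i : ℝ), by
    rw [Module.Basis.mem_span_iff_repr_mem]
    intro i
    simp [b]⟩
  have hφ : Function.Injective φ := by
    intro k l h
    have h' : (fun i => (k i : ℝ)) = fun i => (l i : ℝ) := congrArg Subtype.val h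
    funext i
    have := congrFun h' i
    simpa using this
  have h := hsum.comp_injective hφ
  refine h.congr fun k => ?_
  simp only [Function.comp_apply, Submodule.coe_norm, φ]

lemma summable_inv_sobWeight {s : ℝ} (hs : (d : ℝ) / 2 < s) :
    Summable fun k : Fin d → ℤ => (sobWeight s k)⁻¹ := by
  have hs0 : 0 < s := lt_of_le_of_lt (by positivity) hs
  refine Summable.of_norm_bounded_eventually
    (summable_norm_intCast_rpow (d := d) (r := -(2 * s)) (by linarith)) ?_
  refine (Set.finite_singleton (0 : Fin d → ℤ)).subset fun k hk => ?_
  by_contra hk0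
  refine hk ?_
  have hpos : 0 < ‖(fun i => (k i : ℝ))‖ := by
    rw [norm_pos_iff]
    intro h
    refine hk0 (funext fun i => ?_)
    have := congrFun h i
    simpa using this
  have hle : ‖(fun i => (k i : ℝ))‖ ^ (2 : ℕ) ≤ 1 + ∑ i, ((k i : ℝ)) ^ 2 := by
    have hsq : ‖(fun i => (k i : ℝ))‖ ≤ √(1 + ∑ i, ((k i : ℝ)) ^ 2) := by
      refine (pi_norm_le_iff_of_nonneg (Real.sqrt_nonneg _)).2 fun i => ?_
      refine Real.le_sqrt_of_sq_le ?_
      have := Finset.single_le_sum (f := fun i => ((k i : ℝ)) ^ 2)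
        (fun i _ => sq_nonneg _) (Finset.mem_univ i)
      simp only [Real.norm_eq_abs, sq_abs]
      linarith
    calc _ ≤ √(1 + ∑ i, ((k i : ℝ)) ^ 2) ^ 2 := by gcongr
      _ = _ := Real.sq_sqrt (sobWeight_base_pos k).le
  change ‖(sobWeight s k)⁻¹‖ ≤ ‖(fun i => (k i : ℝ))‖ ^ (-(2 * s))
  rw [Real.norm_of_nonneg (inv_nonneg.2 (sobWeight_pos s k).le), Real.rpow_neg hpos.le]
  refine inv_anti₀ (Real.rpow_pos_of_pos hpos _) ?_
  rw [Real.rpow_mul hpos.le]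
  refine Real.rpow_le_rpow (by positivity) ?_ hs0.le
  exact_mod_cast hle

/-- A constant controlling products in weighted `ℓ²`. -/
def convConst (d : ℕ) (s : ℝ) : ℝ :=
  4 ^ s * (2 * ∑' k : Fin d → ℤ, (sobWeight s k)⁻¹)

lemma convConst_nonneg (s : ℝ) : 0 ≤ convConst d s := by
  have : 0 ≤ ∑' k : Fin d → ℤ, (sobWeight s k)⁻¹ :=
    tsum_nonneg fun k => inv_nonneg.2 (sobWeight_pos s k).le
  unfold convConst
  positivity

lemma sum_inv_sobWeight_mul_le {s : ℝ} (hs : (d : ℝ) / 2 < s) (k : Fin d → ℤ)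
    (S : Finset (Fin d → ℤ)) :
    sobWeight s k * ∑ j ∈ S, (sobWeight s j * sobWeight s (k - j))⁻¹ ≤ convConst d s := by
  have hs0 : 0 ≤ s := le_trans (by positivity) hs.le
  have hsum := summable_inv_sobWeight hs
  have h1 : ∑ j ∈ S, (sobWeight s j)⁻¹ ≤ ∑' k : Fin d → ℤ, (sobWeight s k)⁻¹ :=
    hsum.sum_le_tsum _ fun k _ => inv_nonneg.2 (sobWeight_pos s k).le
  have h2 : ∑ j ∈ S, (sobWeight s (k - j))⁻¹ ≤ ∑' k : Fin d → ℤ, (sobWeight s k)⁻¹ := by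
    rw [← (Equiv.subLeft k).tsum_eq fun k => (sobWeight s k)⁻¹]
    exact ((Equiv.subLeft k).summable_iff.2 hsum).sum_le_tsum _
      fun k _ => inv_nonneg.2 (sobWeight_pos s _).le
  calc sobWeight s k * ∑ j ∈ S, (sobWeight s j * sobWeight s (k - j))⁻¹
      = ∑ j ∈ S, sobWeight s k * (sobWeight s j * sobWeight s (k - j))⁻¹ := Finset.mul_sum _ _ _
    _ ≤ ∑ j ∈ S, 4 ^ s * ((sobWeight s j)⁻¹ + (sobWeight s (k - j))⁻¹) := by
        refine Finset.sum_le_sum fun j _ => ?_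
        have hw := sobWeight_add_le hs0 j (k - j)
        rw [add_sub_cancel] at hw
        have p1 := sobWeight_pos s j
        have p2 := sobWeight_pos s (k - j)
        rw [← div_eq_mul_inv, div_le_iff₀ (by positivity)]
        refine hw.trans (le_of_eq ?_)
        field_simp
        ring
    _ ≤ convConst d s := by
        rw [← Finset.mul_sum, Finset.sum_add_distrib, convConst]
        have : (0 : ℝ) ≤ 4 ^ s := by positivity
        refine mul_le_mul_of_nonneg_left ?_ this
        linarith

/-- A convolution inequality in weighted `ℓ²`. -/
lemma conv_bound {s : ℝ} (hs : (d : ℝ) / 2 < s) {a b c : (Fin d → ℤ) → ℂ}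
    (ha : Summable fun k => sobWeight s k * ‖a k‖ ^ 2)
    (hb : Summable fun k => sobWeight s k * ‖b k‖ ^ 2)
    (hc : ∀ k, HasSum (fun j => a j * b (k - j)) (c k)) :
    Summable (fun k => sobWeight s k * ‖c k‖ ^ 2) ∧
      ∑' k, sobWeight s k * ‖c k‖ ^ 2 ≤ convConst d s *
        ((∑' k, sobWeight s k * ‖a k‖ ^ 2) * ∑' k, sobWeight s k * ‖b k‖ ^ 2) := by
  set p : (Fin d → ℤ) → ℝ := fun k => sobWeight s k * ‖a k‖ ^ 2 with hp
  set q : (Fin d → ℤ) → ℝ := fun k => sobWeight s k * ‖b k‖ ^ 2 with hq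
  have p0 : ∀ k, 0 ≤ p k := fun k => mul_nonneg (sobWeight_pos s k).le (sq_nonneg _)
  have q0 : ∀ k, 0 ≤ q k := fun k => mul_nonneg (sobWeight_pos s k).le (sq_nonneg _)
  have hpq : Summable fun x : (Fin d → ℤ) × (Fin d → ℤ) => p x.1 * q x.2 :=
    ha.mul_of_nonneg hb p0 q0
  let e : (Fin d → ℤ) × (Fin d → ℤ) ≃ (Fin d → ℤ) × (Fin d → ℤ) :=
    { toFun := fun x => (x.2, x.1 - x.2)
      invFun := fun x => (x.1 + x.2, x.1)
      left_inv := fun x => by simp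
      right_inv := fun x => by simp }
  have hpq' : Summable fun x : (Fin d → ℤ) × (Fin d → ℤ) => p x.2 * q (x.1 - x.2) :=
    e.summable_iff.2 hpq
  have hk : ∀ k, Summable fun j => p j * q (k - j) := fun k => hpq'.prod_factor k
  have htot : Summable fun k => ∑' j, p j * q (k - j) := hpq'.prod
  have hsumeq : ∑' k, ∑' j, p j * q (k - j) = (∑' k, p k) * ∑' k, q k := by
    rw [ha.tsum_mul_tsum hb hpq, ← e.tsum_eq]
    exact (hpq'.tsum_prod).symm
  have hbound : ∀ k, sobWeight s k * ‖c k‖ ^ 2 ≤ convConst d s * ∑' j, p j * q (k - j) := by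
    intro k
    have hlim := (((hc k).norm.pow 2).const_mul (sobWeight s k))
    refine le_of_tendsto hlim (Eventually.of_forall fun S => ?_)
    have h1 : ‖∑ j ∈ S, a j * b (k - j)‖ ^ 2 ≤ (∑ j ∈ S, p j * q (k - j)) *
        ∑ j ∈ S, (sobWeight s j * sobWeight s (k - j))⁻¹ := by
      calc ‖∑ j ∈ S, a j * b (k - j)‖ ^ 2 ≤ (∑ j ∈ S, ‖a j‖ * ‖b (k - j)‖) ^ 2 := by
            gcongr
            exact (norm_sum_le _ _).trans_eq (by simp)
        _ ≤ _ := by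
            refine Finset.sum_sq_le_sum_mul_sum_of_sq_le_mul _
              (fun j _ => mul_nonneg (p0 _) (q0 _))
              (fun j _ => inv_nonneg.2 (mul_pos (sobWeight_pos s _) (sobWeight_pos s _)).le)
              fun j _ => ?_
            have p1 := (sobWeight_pos s j).ne'
            have p2 := (sobWeight_pos s (k - j)).ne'
            refine le_of_eq ?_
            simp only [hp, hq]
            field_simp
    have h2 := sum_inv_sobWeight_mul_le hs k S
    have h3 : ∑ j ∈ S, p j * q (k - j) ≤ ∑' j, p j * q (k - j) :=
      (hk k).sum_le_tsum _ fun j _ => mul_nonneg (p0 _) (q0 _)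
    have h4 : 0 ≤ ∑ j ∈ S, p j * q (k - j) :=
      Finset.sum_nonneg fun j _ => mul_nonneg (p0 _) (q0 _)
    calc sobWeight s k * ‖∑ j ∈ S, a j * b (k - j)‖ ^ 2
        ≤ sobWeight s k * ((∑ j ∈ S, p j * q (k - j)) *
          ∑ j ∈ S, (sobWeight s j * sobWeight s (k - j))⁻¹) :=
          mul_le_mul_of_nonneg_left h1 (sobWeight_pos s k).le
      _ = (sobWeight s k * ∑ j ∈ S, (sobWeight s j * sobWeight s (k - j))⁻¹) *
          ∑ j ∈ S, p j * q (k - j) := by ring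
      _ ≤ convConst d s * ∑' j, p j * q (k - j) :=
          mul_le_mul h2 h3 h4 (convConst_nonneg s)
  have hsum : Summable fun k => sobWeight s k * ‖c k‖ ^ 2 :=
    Summable.of_nonneg_of_le (fun k => mul_nonneg (sobWeight_pos s k).le (sq_nonneg _)) hbound
      (htot.mul_left _)
  refine ⟨hsum, ?_⟩
  calc _ ≤ ∑' k, convConst d s * ∑' j, p j * q (k - j) := hsum.tsum_le_tsum hbound (htot.mul_left _)
    _ = _ := by rw [tsum_mul_left, hsumeq]

lemma summable_of_weighted {s : ℝ} (hs : (d : ℝ) / 2 < s) {a : (Fin d → ℤ) → ℂ}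
    (ha : Summable fun k => sobWeight s k * ‖a k‖ ^ 2) : Summable a := by
  refine Summable.of_norm (Summable.of_nonneg_of_le (fun k => norm_nonneg _) (fun k => ?_)
    (ha.add (summable_inv_sobWeight hs)))
  have h := sobWeight_pos s k
  have h2 : ‖a k‖ ≤ ‖a k‖ ^ 2 * sobWeight s k + (sobWeight s k)⁻¹ := by
    have : ‖a k‖ = (√(sobWeight s k) * ‖a k‖) * (√(sobWeight s k))⁻¹ := by
      have := (Real.sqrt_pos.2 h).ne'
      field_simp
    have h3 := two_mul_le_add_sq (√(sobWeight s k) * ‖a k‖) (√(sobWeight s k))⁻¹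
    rw [mul_pow, inv_pow, Real.sq_sqrt h.le] at h3
    nlinarith [norm_nonneg (a k)]
  linarith

open UnitAddTorus

/-! ### Fourier coefficients on the torus -/

/-- The quotient map `ℝ^d → 𝕋^d`. -/
def proj (x : Fin d → ℝ) : UnitAddTorus (Fin d) := fun i => (x i : UnitAddCircle)

lemma isOpenQuotientMap_proj : IsOpenQuotientMap (proj (d := d)) :=
  IsOpenQuotientMap.piMap fun _ => QuotientAddGroup.isOpenQuotientMap_mk

lemma mFourier_proj (n : Fin d → ℤ) (x : Fin d → ℝ) :
    mFourier n (proj x) = Complex.exp (2 * Real.pi * Complex.I * ∑ i, (n i : ℂ) * (x i : ℂ)) := by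
  simp only [mFourier, proj, ContinuousMap.coe_mk, fourier_coe_apply, ← Complex.exp_sum,
    Finset.mul_sum]
  congr 1
  refine Finset.sum_congr rfl fun i _ => ?_
  push_cast
  ring

lemma box_ae_eq : (Set.univ.pi (fun _ : Fin d => Set.Ico (0 : ℝ) 1) : Set (Fin d → ℝ))
    =ᵐ[volume] Set.Icc (0 : Fin d → ℝ) 1 :=
  Measure.univ_pi_Ico_ae_eq_Icc (f := fun _ : Fin d => (0 : ℝ)) (g := fun _ => 1)

lemma tcoeff_eq_integral_Icc (u : (Fin d → ℝ) → ℂ) (k : Fin d → ℤ) :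
    tcoeff u k = ∫ x in Set.Icc (0 : Fin d → ℝ) 1,
      u x * Complex.exp (-2 * Real.pi * Complex.I * (∑ i, (k i : ℂ) * (x i : ℂ))) :=
  setIntegral_congr_set box_ae_eq

lemma tcoeff_comp_proj (u : UnitAddTorus (Fin d) → ℂ) (k : Fin d → ℤ) :
    tcoeff (fun x => u (proj x)) k = mFourierCoeff u k := by
  rw [mFourierCoeff_eq_integral u k 0, tcoeff_eq_integral_Icc]
  have h : {x : Fin d → ℝ | ∀ i, x i ∈ Ioc ((0 : Fin d → ℝ) i) ((0 : Fin d → ℝ) i + 1)}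
      =ᵐ[volume] Set.Icc (0 : Fin d → ℝ) 1 := by
    have := Measure.univ_pi_Ioc_ae_eq_Icc (μ := fun _ : Fin d => (volume : Measure ℝ))
      (f := fun _ : Fin d => (0 : ℝ)) (g := fun _ => 1)
    have hset : {x : Fin d → ℝ | ∀ i, x i ∈ Ioc ((0 : Fin d → ℝ) i) ((0 : Fin d → ℝ) i + 1)}
        = Set.univ.pi fun _ => Ioc (0 : ℝ) 1 := by
      ext x
      simp [Set.mem_pi]
    rw [hset]
    exact this
  rw [setIntegral_congr_set h]
  refine integral_congr_ae (Eventually.of_forall fun x => ?_)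
  change _ = mFourier (-k) (proj x) • u (proj x)
  rw [mFourier_proj, smul_eq_mul, mul_comm (Complex.exp _)]
  simp only [Pi.neg_apply, Int.cast_neg, neg_mul, Finset.sum_neg_distrib, mul_neg]

lemma continuous_expfac (k : Fin d → ℤ) : Continuous fun x : Fin d → ℝ =>
    Complex.exp (-2 * Real.pi * Complex.I * (∑ i, (k i : ℂ) * (x i : ℂ))) := by
  fun_prop

lemma norm_expfac (k : Fin d → ℤ) (x : Fin d → ℝ) :
    ‖Complex.exp (-2 * Real.pi * Complex.I * (∑ i, (k i : ℂ) * (x i : ℂ)))‖ = 1 := by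
  have : (-2 * Real.pi * Complex.I * (∑ i, (k i : ℂ) * (x i : ℂ)))
      = ((-2 * Real.pi * ∑ i, (k i : ℝ) * x i : ℝ) : ℂ) * Complex.I := by
    push_cast
    ring
  rw [this, Complex.norm_exp_ofReal_mul_I]

lemma integrableOn_tcoeff {u : (Fin d → ℝ) → ℂ} (hu : Continuous u) (k : Fin d → ℤ) :
    IntegrableOn (fun x => u x * Complex.exp (-2 * Real.pi * Complex.I *
      (∑ i, (k i : ℂ) * (x i : ℂ)))) (Set.Icc (0 : Fin d → ℝ) 1) :=
  (hu.mul (continuous_expfac k)).continuousOn.integrableOn_compact isCompact_Icc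

lemma tcoeff_add {u v : (Fin d → ℝ) → ℂ} (hu : Continuous u) (hv : Continuous v)
    (k : Fin d → ℤ) : tcoeff (fun x => u x + v x) k = tcoeff u k + tcoeff v k := by
  simp only [tcoeff_eq_integral_Icc, add_mul]
  exact integral_add (integrableOn_tcoeff hu k) (integrableOn_tcoeff hv k)

lemma tcoeff_const_mul (c : ℂ) (u : (Fin d → ℝ) → ℂ) (k : Fin d → ℤ) :
    tcoeff (fun x => c * u x) k = c * tcoeff u k := by
  simp only [tcoeff, mul_assoc]
  exact integral_const_mul _ _

lemma volume_Icc_zero_one : (volume : Measure (Fin d → ℝ)).real (Set.Icc 0 1) = 1 := by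
  simp [Measure.real, Real.volume_Icc_pi]

lemma norm_tcoeff_le {u : (Fin d → ℝ) → ℂ} {C : ℝ} (hC : ∀ x, ‖u x‖ ≤ C) (k : Fin d → ℤ) :
    ‖tcoeff u k‖ ≤ C := by
  rw [tcoeff_eq_integral_Icc]
  refine (norm_setIntegral_le_of_norm_le_const (C := C) ?_ fun x _ => ?_).trans ?_
  · exact isCompact_Icc.measure_lt_top
  · rw [norm_mul, norm_expfac, mul_one]
    exact hC x
  · rw [volume_Icc_zero_one, mul_one]

/-- The Fourier coefficient as a continuous linear functional on `C(𝕋^d, ℂ)`. -/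
def coeffCLM (k : Fin d → ℤ) : C(UnitAddTorus (Fin d), ℂ) →L[ℂ] ℂ :=
  LinearMap.mkContinuous
    { toFun := fun u => mFourierCoeff u k
      map_add' := fun u v => by
        simp only [← tcoeff_comp_proj]
        exact tcoeff_add (u.continuous.comp isOpenQuotientMap_proj.continuous)
          (v.continuous.comp isOpenQuotientMap_proj.continuous) k
      map_smul' := fun c u => by
        simp only [← tcoeff_comp_proj]
        exact tcoeff_const_mul c _ k } 1 fun u => by
    change ‖mFourierCoeff u k‖ ≤ _
    rw [← tcoeff_comp_proj, one_mul]
    exact norm_tcoeff_le (fun x => u.norm_coe_le_norm _) k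

@[simp] lemma coeffCLM_apply (k : Fin d → ℤ) (u : C(UnitAddTorus (Fin d), ℂ)) :
    coeffCLM k u = mFourierCoeff u k := rfl

lemma mFourierCoeff_mFourier (m k : Fin d → ℤ) :
    mFourierCoeff (mFourier m) k = if k = m then 1 else 0 := by
  classical
  rw [← mFourierCoeff_toLp, ← mFourierBasis_repr]
  have h := (mFourierBasis (d := Fin d)).repr_self m
  rw [coe_mFourierBasis] at h
  rw [h, lp.single_apply, Pi.single_apply]

lemma mFourierCoeff_mFourier_mul (j k : Fin d → ℤ) (u : C(UnitAddTorus (Fin d), ℂ)) :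
    mFourierCoeff (mFourier j * u : C(UnitAddTorus (Fin d), ℂ)) k = mFourierCoeff u (k - j) := by
  unfold mFourierCoeff
  congr 1
  funext x
  simp only [ContinuousMap.mul_apply, smul_eq_mul]
  rw [← mul_assoc, ← mFourier_add]
  congr 2
  abel_nf

lemma hasSum_mFourierCoeff_mul {u : C(UnitAddTorus (Fin d), ℂ)} (hu : Summable (mFourierCoeff u))
    (v : C(UnitAddTorus (Fin d), ℂ)) (k : Fin d → ℤ) :
    HasSum (fun j => mFourierCoeff u j * mFourierCoeff v (k - j))
      (mFourierCoeff (u * v : C(UnitAddTorus (Fin d), ℂ)) k) := by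
  have h := (coeffCLM k).hasSum ((hasSum_mFourier_series_of_summable hu).mul_right v)
  refine h.congr_fun fun j => ?_
  rw [smul_mul_assoc, map_smul, coeffCLM_apply, mFourierCoeff_mFourier_mul,
    smul_eq_mul]

/-! ### The Sobolev algebra -/

/-- The Sobolev space `H^s(𝕋^d; ℂ)`, `s > d/2`, as a subalgebra of `C(𝕋^d, ℂ)`. -/
def hsSubalgebra (d : ℕ) (s : ℝ) [hs : Fact ((d : ℝ) / 2 < s)] :
    Subalgebra ℂ C(UnitAddTorus (Fin d), ℂ) where
  carrier := {u | Summable fun k => sobWeight s k * ‖mFourierCoeff u k‖ ^ 2}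
  mul_mem' {u v} hu hv :=
    (conv_bound hs.out hu hv (hasSum_mFourierCoeff_mul (summable_of_weighted hs.out hu) v)).1
  add_mem' {u v} hu hv := by
    refine Summable.of_nonneg_of_le
      (fun k => mul_nonneg (sobWeight_pos s k).le (sq_nonneg _)) (fun k => ?_)
      ((hu.add hv).mul_left 2)
    have h1 : mFourierCoeff (u + v : C(UnitAddTorus (Fin d), ℂ)) k
      = mFourierCoeff u k + mFourierCoeff v k := (coeffCLM k).map_add u v
    have h2 : ‖mFourierCoeff u k + mFourierCoeff v k‖ ^ 2
        ≤ 2 * (‖mFourierCoeff u k‖ ^ 2 + ‖mFourierCoeff v k‖ ^ 2) :=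
      (pow_le_pow_left₀ (norm_nonneg _) (norm_add_le _ _) 2).trans add_sq_le
    rw [h1]
    nlinarith [sobWeight_pos s k]
  algebraMap_mem' c := by
    refine summable_of_ne_finset_zero (s := {0}) fun k hk => ?_
    have h : (algebraMap ℂ C(UnitAddTorus (Fin d), ℂ) c) = c • mFourier 0 := by
      rw [mFourier_zero, Algebra.algebraMap_eq_smul_one]
    have h2 : mFourierCoeff (algebraMap ℂ C(UnitAddTorus (Fin d), ℂ) c) k
        = c • mFourierCoeff (mFourier 0) k := by
      rw [h]
      exact (coeffCLM k).map_smul c _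
    rw [h2, mFourierCoeff_mFourier, if_neg (by simpa using hk)]
    simp

/-- The Sobolev space `H^s(𝕋^d; ℂ)`, `s > d/2`, with its own Banach algebra norm. -/
def HsAlg (d : ℕ) (s : ℝ) [Fact ((d : ℝ) / 2 < s)] : Type := hsSubalgebra d s

namespace HsAlg

variable {s : ℝ}

/-- The normalization making the norm submultiplicative. -/
def nrm (d : ℕ) (s : ℝ) : ℝ := √(convConst d s + 1)

lemma nrm_pos : 0 < nrm d s := Real.sqrt_pos.2 (by linarith [convConst_nonneg (d := d) s])

lemma sq_nrm : nrm d s ^ 2 = convConst d s + 1 :=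
  Real.sq_sqrt (by linarith [convConst_nonneg (d := d) s])

/-- The scaling factors of the coefficient isometry. -/
def fac (s : ℝ) (k : Fin d → ℤ) : ℂ := ((nrm d s * √(sobWeight s k) : ℝ) : ℂ)

lemma fac_ne_zero (k : Fin d → ℤ) : fac s k ≠ 0 := by
  have := mul_pos (nrm_pos (d := d) (s := s)) (Real.sqrt_pos.2 (sobWeight_pos s k))
  exact Complex.ofReal_ne_zero.2 this.ne'

lemma norm_fac_mul_sq (k : Fin d → ℤ) (z : ℂ) :
    ‖fac s k * z‖ ^ 2 = nrm d s ^ 2 * (sobWeight s k * ‖z‖ ^ 2) := by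
  rw [norm_mul, fac, Complex.norm_real, mul_pow, Real.norm_eq_abs, sq_abs, mul_pow,
    Real.sq_sqrt (sobWeight_pos s k).le, mul_assoc]

variable [hs : Fact ((d : ℝ) / 2 < s)]

instance : CommRing (HsAlg d s) := inferInstanceAs (CommRing (hsSubalgebra d s))

instance : Algebra ℂ (HsAlg d s) := inferInstanceAs (Algebra ℂ (hsSubalgebra d s))

/-- The underlying continuous function. -/
def toC : HsAlg d s →ₐ[ℂ] C(UnitAddTorus (Fin d), ℂ) := (hsSubalgebra d s).val

lemma toC_injective : Function.Injective (toC (d := d) (s := s)) := Subtype.val_injective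

lemma summable_weighted (u : HsAlg d s) :
    Summable fun k => sobWeight s k * ‖mFourierCoeff (toC u) k‖ ^ 2 := u.2

/-- Build an element of the algebra from a continuous function. -/
def mk (u : C(UnitAddTorus (Fin d), ℂ))
    (hu : Summable fun k => sobWeight s k * ‖mFourierCoeff u k‖ ^ 2) : HsAlg d s := ⟨u, hu⟩

@[simp] lemma toC_mk (u : C(UnitAddTorus (Fin d), ℂ)) (hu) : toC (mk (s := s) u hu) = u := rfl

/-- Weighted Fourier coefficients as an element of `ℓ²`. -/
def coef : HsAlg d s →ₗ[ℂ] lp (fun _ : Fin d → ℤ => ℂ) 2 where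
  toFun u := ⟨fun k => fac s k * mFourierCoeff (toC u) k, by
    refine memℓp_gen ?_
    simp only [ENNReal.toReal_ofNat, Real.rpow_ofNat, norm_fac_mul_sq]
    exact (summable_weighted u).mul_left _⟩
  map_add' u v := by
    ext k
    have h : mFourierCoeff (toC (u + v)) k
      = mFourierCoeff (toC u) k + mFourierCoeff (toC v) k := by
      rw [map_add]
      exact (coeffCLM k).map_add _ _
    change fac s k * mFourierCoeff (toC (u + v)) k
      = fac s k * mFourierCoeff (toC u) k + fac s k * mFourierCoeff (toC v) k
    rw [h, mul_add]
  map_smul' c u := by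
    ext k
    have h : mFourierCoeff (toC (c • u)) k = c * mFourierCoeff (toC u) k := by
      rw [map_smul]
      exact (coeffCLM k).map_smul _ _
    change fac s k * mFourierCoeff (toC (c • u)) k = c * (fac s k * mFourierCoeff (toC u) k)
    rw [h]
    ring

lemma coef_apply (u : HsAlg d s) (k : Fin d → ℤ) :
    coef u k = fac s k * mFourierCoeff (toC u) k := rfl

lemma summable_coeff (u : HsAlg d s) : Summable (mFourierCoeff (toC u)) :=
  summable_of_weighted hs.out (summable_weighted u)

lemma coef_injective : Function.Injective (coef (d := d) (s := s)) := by
  intro u v h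
  refine toC_injective ?_
  have h1 : ∀ k, mFourierCoeff (toC u) k = mFourierCoeff (toC v) k := fun k => by
    have := congrArg (fun x : lp (fun _ : Fin d → ℤ => ℂ) 2 => x k) h
    simp only [coef_apply] at this
    exact mul_left_cancel₀ (fac_ne_zero k) this
  have hu := hasSum_mFourier_series_of_summable (summable_coeff u)
  simp only [h1] at hu
  exact hu.unique (hasSum_mFourier_series_of_summable (summable_coeff v))

lemma norm_coef_sq (u : HsAlg d s) :
    ‖coef u‖ ^ 2 = nrm d s ^ 2 * ∑' k, sobWeight s k * ‖mFourierCoeff (toC u) k‖ ^ 2 := by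
  have h := lp.norm_rpow_eq_tsum (p := 2) (by simp) (coef u)
  simp only [ENNReal.toReal_ofNat, Real.rpow_ofNat, coef_apply, norm_fac_mul_sq] at h
  rw [h, tsum_mul_left]

lemma coef_surjective : Function.Surjective (coef (d := d) (s := s)) := by
  intro a
  have ha : Summable fun k => ‖a k‖ ^ 2 := by
    simpa using (lp.memℓp a).summable (by simp)
  set b : (Fin d → ℤ) → ℂ := fun k => (fac s k)⁻¹ * a k with hb
  have hfb : ∀ k, fac s k * b k = a k := fun k => by
    simp only [hb]
    rw [mul_inv_cancel_left₀ (fac_ne_zero k)]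
  have hbs : Summable fun k => sobWeight s k * ‖b k‖ ^ 2 := by
    refine (ha.mul_left (nrm d s ^ 2)⁻¹).congr fun k => ?_
    rw [← hfb, norm_fac_mul_sq]
    have := (nrm_pos (d := d) (s := s)).ne'
    field_simp
  have hb1 := (summable_of_weighted hs.out hbs).norm
  have hsum : Summable fun k => b k • mFourier k :=
    Summable.of_norm (by simpa only [norm_smul, mFourier_norm, mul_one] using hb1)
  have hcoeff : ∀ k, mFourierCoeff (∑' k, b k • mFourier k : C(UnitAddTorus (Fin d), ℂ)) k
      = b k := fun k => by
    have h := (coeffCLM k).hasSum hsum.hasSum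
    refine h.unique ?_
    refine (hasSum_ite_eq k (b k)).congr_fun fun j => ?_
    simp only [map_smul, coeffCLM_apply, mFourierCoeff_mFourier, smul_eq_mul]
    by_cases hjk : k = j
    · simp [hjk]
    · simp [hjk, Ne.symm hjk]
  refine ⟨mk (∑' k, b k • mFourier k) (by simpa only [hcoeff] using hbs), ?_⟩
  ext k
  rw [coef_apply, toC_mk, hcoeff, hfb]

instance : NormedCommRing (HsAlg d s) :=
  { NormedAddCommGroup.induced (HsAlg d s) (lp (fun _ : Fin d → ℤ => ℂ) 2) coef coef_injective,
    (inferInstance : CommRing (HsAlg d s)) with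
    norm_mul_le := fun u v => by
      change ‖coef (u * v)‖ ≤ ‖coef u‖ * ‖coef v‖
      refine le_of_sq_le_sq ?_ (by positivity)
      rw [mul_pow, norm_coef_sq, norm_coef_sq, norm_coef_sq]
      have h := (conv_bound hs.out (summable_weighted u) (summable_weighted v)
        (hasSum_mFourierCoeff_mul (summable_coeff u) (toC v))).2
      rw [← map_mul] at h
      set U := ∑' k, sobWeight s k * ‖mFourierCoeff (toC u) k‖ ^ 2
      set V := ∑' k, sobWeight s k * ‖mFourierCoeff (toC v) k‖ ^ 2
      have hU : 0 ≤ U := tsum_nonneg fun k => mul_nonneg (sobWeight_pos s k).le (sq_nonneg _)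
      have hV : 0 ≤ V := tsum_nonneg fun k => mul_nonneg (sobWeight_pos s k).le (sq_nonneg _)
      have hUV := mul_nonneg hU hV
      have hn : 0 ≤ nrm d s ^ 2 := sq_nonneg _
      calc _ ≤ nrm d s ^ 2 * (convConst d s * (U * V)) := mul_le_mul_of_nonneg_left h hn
        _ ≤ nrm d s ^ 2 * (nrm d s ^ 2 * (U * V)) := by
          refine mul_le_mul_of_nonneg_left (mul_le_mul_of_nonneg_right ?_ hUV) hn
          rw [sq_nrm]
          linarith
        _ = _ := by ring }

lemma norm_def (u : HsAlg d s) : ‖u‖ = ‖coef u‖ := rfl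

instance : NormedAlgebra ℂ (HsAlg d s) where
  norm_smul_le c u := by
    rw [norm_def, norm_def, map_smul, norm_smul]

/-- The weighted Fourier transform as an isometric isomorphism. -/
def coefIso : HsAlg d s ≃ₗᵢ[ℂ] lp (fun _ : Fin d → ℤ => ℂ) 2 where
  toLinearEquiv := LinearEquiv.ofBijective coef ⟨coef_injective, coef_surjective⟩
  norm_map' _ := rfl

@[simp] lemma coefIso_apply (u : HsAlg d s) : coefIso u = coef u := rfl

instance : CompleteSpace (HsAlg d s) :=
  (completeSpace_congr (e := (coefIso (d := d) (s := s)).toEquiv)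
    coefIso.isometry.isUniformEmbedding).2 inferInstance

lemma norm_eq_sobNorm (u : HsAlg d s) :
    ‖u‖ = nrm d s * sobNorm s fun x => toC u (proj x) := by
  have h0 : 0 ≤ sobNormSq s fun x => toC u (proj x) :=
    tsum_nonneg fun k => mul_nonneg (sobWeight_pos s k).le (sq_nonneg _)
  refine (sq_eq_sq₀ (norm_nonneg _) (mul_nonneg nrm_pos.le (Real.sqrt_nonneg _))).1 ?_
  rw [norm_def, norm_coef_sq, mul_pow, Real.sq_sqrt h0]
  simp only [sobNormSq, tcoeff_comp_proj]

/-! ### Characters of the Sobolev algebra -/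

/-- Evaluation at a point of the torus. -/
def eval (x : UnitAddTorus (Fin d)) : HsAlg d s →ₐ[ℂ] ℂ :=
  ((ContinuousMap.evalAlgHom ℂ ℂ x : C(UnitAddTorus (Fin d), ℂ) →ₐ[ℂ] ℂ)).comp toC

lemma continuous_eval (x : UnitAddTorus (Fin d)) : Continuous (eval (s := s) x) := by
  refine AddMonoidHomClass.continuous_of_bound (eval (s := s) x) ‖(1 : HsAlg d s)‖ fun u => ?_
  rw [mul_comm]
  exact AlgHom.norm_apply_le_self_mul_norm_one (eval x) u

/-- Evaluation as a continuous linear functional. -/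
def evalCLM (x : UnitAddTorus (Fin d)) : HsAlg d s →L[ℂ] ℂ :=
  ⟨(eval x).toLinearMap, continuous_eval x⟩

lemma evalCLM_apply (x : UnitAddTorus (Fin d)) (u : HsAlg d s) : evalCLM x u = toC u x := rfl

/-- The trigonometric monomials. -/
def mono (k : Fin d → ℤ) : HsAlg d s :=
  mk (mFourier k) <| summable_of_ne_finset_zero (s := {k}) fun j hj => by
    rw [mFourierCoeff_mFourier, if_neg (by simpa using hj)]
    simp

lemma mono_add (k j : Fin d → ℤ) : mono (s := s) (k + j) = mono k * mono j := by
  refine toC_injective ?_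
  rw [map_mul]
  ext x
  exact mFourier_add

lemma mono_zero : mono (s := s) (0 : Fin d → ℤ) = 1 := by
  refine toC_injective ?_
  rw [map_one]
  exact mFourier_zero

lemma norm_mono (k : Fin d → ℤ) : ‖mono (s := s) k‖ = nrm d s * √(sobWeight s k) := by
  rw [← sq_eq_sq₀ (norm_nonneg _) (mul_nonneg nrm_pos.le (Real.sqrt_nonneg _)), norm_def,
    norm_coef_sq, mul_pow, Real.sq_sqrt (sobWeight_pos s k).le, tsum_eq_single k]
  · simp [mono, mFourierCoeff_mFourier]
  · intro j hj
    simp [mono, mFourierCoeff_mFourier, hj]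

lemma hasSum_mono (u : HsAlg d s) : HasSum (fun k => mFourierCoeff (toC u) k • mono k) u := by
  have h := lp.hasSum_single (p := 2) (by simp) (coef u)
  have h2 := h.map (coefIso (d := d) (s := s)).symm (coefIso (d := d) (s := s)).symm.continuous
  have h3 : (coefIso (d := d) (s := s)).symm (coef u) = u := by
    rw [← coefIso_apply, LinearIsometryEquiv.symm_apply_apply]
  rw [h3] at h2
  refine h2.congr_fun fun k => ?_
  rw [Function.comp_apply, LinearIsometryEquiv.eq_symm_apply, coefIso_apply]
  ext j
  rw [coef_apply, map_smul, lp.single_apply, Pi.single_apply, coef_apply]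
  have h4 : mFourierCoeff (mFourierCoeff (toC u) k • toC (mono (s := s) k) :
      C(UnitAddTorus (Fin d), ℂ)) j = mFourierCoeff (toC u) k * mFourierCoeff (mFourier k) j :=
    (coeffCLM j).map_smul _ _
  rw [h4, mFourierCoeff_mFourier]
  split_ifs with hjk
  · rw [hjk, mul_one]
  · simp

lemma norm_map_mono_le_one (χ : HsAlg d s →ₐ[ℂ] ℂ) (k : Fin d → ℤ) : ‖χ (mono k)‖ ≤ 1 := by
  by_contra! hlt
  have hs0 : 0 < s := lt_of_le_of_lt (by positivity) hs.out
  have hpow : ∀ n : ℕ, χ (mono k) ^ n = χ (mono (n • k)) := by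
    intro n
    induction n with
    | zero => rw [pow_zero, zero_smul, mono_zero, map_one]
    | succ n ih => rw [pow_succ, ih, succ_nsmul, mono_add, map_mul]
  obtain ⟨m, hm⟩ := exists_nat_ge s
  set B : ℝ := 1 + ∑ i, ((k i : ℝ)) ^ 2 with hB
  have hB0 : 0 < B := sobWeight_base_pos k
  set K : ℝ := nrm d s * ‖(1 : HsAlg d s)‖ * √(B ^ s) with hK
  have hbd : ∀ n : ℕ, 1 ≤ n → ‖χ (mono k)‖ ^ n ≤ K * (n : ℝ) ^ m := by
    intro n hn
    have hn1 : (1 : ℝ) ≤ n := by exact_mod_cast hn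
    have hw : √(sobWeight s (n • k)) ≤ √(B ^ s) * (n : ℝ) ^ m := by
      have h1 : sobWeight s (n • k) ≤ B ^ s * ((n : ℝ) ^ m) ^ 2 := by
        calc sobWeight s (n • k) ≤ (B * (n : ℝ) ^ 2) ^ s := by
              refine Real.rpow_le_rpow (sobWeight_base_pos _).le ?_ hs0.le
              have : ∑ i, (((n • k) i : ℤ) : ℝ) ^ 2 = (n : ℝ) ^ 2 * ∑ i, ((k i : ℝ)) ^ 2 := by
                rw [Finset.mul_sum]
                refine Finset.sum_congr rfl fun i _ => ?_
                simp [mul_pow]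
              rw [this, hB]
              nlinarith
          _ = B ^ s * ((n : ℝ) ^ 2) ^ s := Real.mul_rpow hB0.le (by positivity)
          _ ≤ B ^ s * ((n : ℝ) ^ m) ^ 2 := by
              refine mul_le_mul_of_nonneg_left ?_ (by positivity)
              rw [← pow_mul, mul_comm m 2, pow_mul, ← Real.rpow_natCast _ m]
              exact Real.rpow_le_rpow_of_exponent_le (one_le_pow₀ hn1) hm
      refine (Real.sqrt_le_sqrt h1).trans ?_
      rw [Real.sqrt_mul (by positivity), Real.sqrt_sq (by positivity)]
    rw [← norm_pow, hpow]
    calc ‖χ (mono (n • k))‖ ≤ ‖mono (s := s) (n • k)‖ * ‖(1 : HsAlg d s)‖ :=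
          AlgHom.norm_apply_le_self_mul_norm_one χ _
      _ = nrm d s * ‖(1 : HsAlg d s)‖ * √(sobWeight s (n • k)) := by rw [norm_mono]; ring
      _ ≤ nrm d s * ‖(1 : HsAlg d s)‖ * (√(B ^ s) * (n : ℝ) ^ m) :=
          mul_le_mul_of_nonneg_left hw (mul_nonneg nrm_pos.le (norm_nonneg _))
      _ = K * (n : ℝ) ^ m := by rw [hK]; ring
  have hlim := (tendsto_pow_const_div_const_pow_of_one_lt m hlt).const_mul K
  rw [mul_zero] at hlim
  obtain ⟨n, hn, hn1⟩ := ((hlim.eventually (gt_mem_nhds one_pos)).and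
    (eventually_ge_atTop 1)).exists
  have hp : 0 < ‖χ (mono k)‖ ^ n := pow_pos (one_pos.trans hlt) n
  rw [← mul_div_assoc, div_lt_one hp] at hn
  exact absurd (hbd n hn1) (not_le.2 hn)

lemma norm_map_mono (χ : HsAlg d s →ₐ[ℂ] ℂ) (k : Fin d → ℤ) : ‖χ (mono k)‖ = 1 := by
  refine le_antisymm (norm_map_mono_le_one χ k) ?_
  have h : χ (mono k) * χ (mono (-k)) = 1 := by
    rw [← map_mul, ← mono_add, add_neg_cancel, mono_zero, map_one]
  have h2 := congrArg norm h
  rw [norm_mul, norm_one] at h2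
  nlinarith [norm_map_mono_le_one χ (-k), norm_nonneg (χ (mono k)), norm_nonneg (χ (mono (-k)))]

/-- Every character of the Sobolev algebra is the evaluation at a point. -/
lemma exists_eq_eval (χ : HsAlg d s →ₐ[ℂ] ℂ) :
    ∃ x : UnitAddTorus (Fin d), ∀ u, χ u = toC u x := by
  have hcirc : ∀ i : Fin d, ∃ t : UnitAddCircle, fourier 1 t = χ (mono (Pi.single i 1)) := by
    intro i
    refine ⟨((Complex.arg (χ (mono (Pi.single i 1))) / (2 * Real.pi) : ℝ) : UnitAddCircle), ?_⟩
    rw [fourier_coe_apply]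
    have h := Complex.norm_mul_exp_arg_mul_I (χ (mono (Pi.single i 1)))
    rw [norm_map_mono, Complex.ofReal_one, one_mul] at h
    rw [← h]
    congr 1
    have : (Real.pi : ℂ) ≠ 0 := by exact_mod_cast Real.pi_ne_zero
    push_cast
    rw [h]
    field_simp
  choose x hx using hcirc
  refine ⟨x, ?_⟩
  let f : Multiplicative (Fin d → ℤ) →* ℂ :=
    { toFun := fun k => χ (mono k.toAdd)
      map_one' := by
        change χ (mono 0) = 1
        rw [mono_zero, map_one]
      map_mul' := fun k j => by
        change χ (mono (k.toAdd + j.toAdd)) = _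
        rw [mono_add, map_mul] }
  let g : Multiplicative (Fin d → ℤ) →* ℂ :=
    { toFun := fun k => mFourier k.toAdd x
      map_one' := by
        change mFourier 0 x = 1
        rw [mFourier_zero, ContinuousMap.one_apply]
      map_mul' := fun k j => mFourier_add }
  have hmono : ∀ k : Fin d → ℤ, χ (mono k) = mFourier k x := by
    have hsingle : ∀ (i : Fin d) (n : ℤ), χ (mono (Pi.single i n)) = mFourier (Pi.single i n) x := by
      intro i n
      let ι : Multiplicative ℤ →* Multiplicative (Fin d → ℤ) :=
        AddMonoidHom.toMultiplicative (AddMonoidHom.single (fun _ : Fin d => ℤ) i)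
      have h : f.comp ι = g.comp ι := by
        refine MonoidHom.ext_mint ?_
        change χ (mono (Pi.single i 1)) = mFourier (Pi.single i 1) x
        rw [mFourier_single, hx]
      exact DFunLike.congr_fun h (Multiplicative.ofAdd n)
    intro k
    have hk : k = ∑ i, Pi.single i (k i) := (Finset.univ_sum_single k).symm
    have hf : ∀ S : Finset (Fin d), χ (mono (∑ i ∈ S, Pi.single i (k i)))
        = mFourier (∑ i ∈ S, Pi.single i (k i)) x := by
      intro S
      induction S using Finset.induction_on with
      | empty => rw [Finset.sum_empty, mono_zero, map_one, mFourier_zero, ContinuousMap.one_apply]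
      | insert i S hi ih =>
        rw [Finset.sum_insert hi, mono_add, map_mul, ih, hsingle, mFourier_add]
    rw [hk]
    exact hf _
  intro u
  have hχ : Continuous χ := by
    refine AddMonoidHomClass.continuous_of_bound χ ‖(1 : HsAlg d s)‖ fun u => ?_
    rw [mul_comm]
    exact AlgHom.norm_apply_le_self_mul_norm_one χ u
  have h1 := (hasSum_mono u).map χ hχ
  have h2 := hasSum_mFourier_series_apply_of_summable (summable_coeff u) x
  refine h1.unique (h2.congr_fun fun k => ?_)
  rw [Function.comp_apply, map_smul, hmono]

/-- The Sobolev algebra is inverse closed in the continuous functions. -/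
lemma isUnit_of_forall_ne_zero (u : HsAlg d s) (h : ∀ x, toC u x ≠ 0) : IsUnit u := by
  by_contra hu
  obtain ⟨χ, hχ⟩ := WeakDual.CharacterSpace.exists_apply_eq_zero hu
  obtain ⟨x, hx⟩ := exists_eq_eval (WeakDual.CharacterSpace.toAlgHom χ)
  exact h x ((hx u).symm.trans hχ)

lemma toC_inverse_apply {u : HsAlg d s} (hu : IsUnit u) (x : UnitAddTorus (Fin d)) :
    toC (Ring.inverse u) x = (toC u x)⁻¹ := by
  have h : toC u x * toC (Ring.inverse u) x = 1 := by
    rw [← ContinuousMap.mul_apply, ← map_mul, Ring.mul_inverse_cancel _ hu, map_one,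
      ContinuousMap.one_apply]
  exact eq_inv_of_mul_eq_one_right h

end HsAlg

/-! ### Cauchy's formula on a rectangle -/

/-- The boundary integral over the rectangle `[-M, M] × [-δ, δ]`. -/
def rectInt (M δ : ℝ) (g : ℂ → ℂ) : ℂ :=
  (∫ x : ℝ in -M..M, g (x + (-δ : ℝ) * Complex.I)) - (∫ x : ℝ in -M..M, g (x + δ * Complex.I)) +
    Complex.I • (∫ y : ℝ in -δ..δ, g (M + y * Complex.I)) -
    Complex.I • (∫ y : ℝ in -δ..δ, g ((-M : ℝ) + y * Complex.I))

lemma integral_deriv_log {γ : ℝ → ℂ} {γ' : ℂ} {a b : ℝ} (hγ : ∀ t, HasDerivAt γ γ' t)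
    (hs : ∀ t ∈ uIcc a b, γ t ∈ Complex.slitPlane) :
    γ' * ∫ t in a..b, (γ t)⁻¹ = Complex.log (γ b) - Complex.log (γ a) := by
  have hc : Continuous γ := continuous_iff_continuousAt.2 fun t => (hγ t).continuousAt
  rw [← intervalIntegral.integral_const_mul]
  refine intervalIntegral.integral_eq_sub_of_hasDerivAt
    (f := fun t => Complex.log (γ t)) (fun t ht => ?_) ?_
  · have := (hγ t).clog_real (hs t ht)
    rwa [div_eq_mul_inv] at this
  · refine ContinuousOn.intervalIntegrable ?_
    exact continuousOn_const.mul (hc.continuousOn.inv₀ fun t ht =>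
      Complex.slitPlane_ne_zero (hs t ht))

lemma hasDerivAt_horizontal (c : ℂ) (t : ℝ) : HasDerivAt (fun t : ℝ => (t : ℂ) + c) 1 t :=
  Complex.ofRealCLM.hasDerivAt.add_const c

lemma hasDerivAt_vertical (c : ℂ) (t : ℝ) :
    HasDerivAt (fun t : ℝ => c + (t : ℂ) * Complex.I) Complex.I t := by
  simpa using ((Complex.ofRealCLM.hasDerivAt (x := t)).mul_const Complex.I).const_add c

lemma log_sub_log_neg_of_im_pos {z : ℂ} (hz : 0 < z.im) :
    Complex.log z - Complex.log (-z) = Real.pi * Complex.I := by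
  rw [Complex.log, Complex.log, Complex.arg_neg_eq_arg_sub_pi_of_im_pos hz, norm_neg]
  push_cast
  ring

lemma rectInt_inv_sub {M δ r : ℝ} (hδ : 0 < δ) (hr : |r| < M) :
    rectInt M δ (fun ζ => (ζ - r)⁻¹) = 2 * Real.pi * Complex.I := by
  obtain ⟨h1, h2⟩ := abs_lt.1 hr
  have bot := integral_deriv_log (a := -M) (b := M)
    (hasDerivAt_horizontal (((-δ : ℝ) : ℂ) * Complex.I - r)) fun t _ => by
      refine Complex.mem_slitPlane_iff.2 (Or.inr ?_)
      simp [hδ.ne']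
  have top := integral_deriv_log (a := -M) (b := M)
    (hasDerivAt_horizontal ((δ : ℂ) * Complex.I - r)) fun t _ => by
      refine Complex.mem_slitPlane_iff.2 (Or.inr ?_)
      simp [hδ.ne']
  have right := integral_deriv_log (a := -δ) (b := δ)
    (hasDerivAt_vertical ((M : ℂ) - r)) fun t _ => by
      refine Complex.mem_slitPlane_iff.2 (Or.inl ?_)
      simp [h2]
  have left := integral_deriv_log (γ := fun t : ℝ => -(((-M : ℝ) : ℂ) - r + t * Complex.I))
    (a := -δ) (b := δ) (fun t => (hasDerivAt_vertical (((-M : ℝ) : ℂ) - r) t).neg) fun t _ => by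
      refine Complex.mem_slitPlane_iff.2 (Or.inl ?_)
      simp
      linarith
  have up := log_sub_log_neg_of_im_pos (z := ((-M : ℝ) : ℂ) - r + δ * Complex.I) (by simpa using hδ)
  have down := log_sub_log_neg_of_im_pos
    (z := -(((-M : ℝ) : ℂ) - r + ((-δ : ℝ) : ℂ) * Complex.I)) (by simpa using hδ)
  rw [neg_neg] at down
  simp only [inv_neg, intervalIntegral.integral_neg] at left
  have e1 : ∀ (x : ℝ) (c : ℂ), (x : ℂ) + c - r = x + (c - r) := fun x c => by ring
  have e2 : ∀ (y : ℝ) (c : ℂ), c + (y : ℂ) * Complex.I - r = c - r + y * Complex.I :=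
    fun y c => by ring
  have E1 : (∫ x : ℝ in -M..M, ((x : ℂ) + (-δ : ℝ) * Complex.I - r)⁻¹)
      = ∫ x : ℝ in -M..M, ((x : ℂ) + ((-δ : ℝ) * Complex.I - r))⁻¹ := by simp only [e1]
  have E2 : (∫ x : ℝ in -M..M, ((x : ℂ) + δ * Complex.I - r)⁻¹)
      = ∫ x : ℝ in -M..M, ((x : ℂ) + (δ * Complex.I - r))⁻¹ := by simp only [e1]
  have E3 : (∫ y : ℝ in -δ..δ, ((M : ℂ) + y * Complex.I - r)⁻¹)
      = ∫ y : ℝ in -δ..δ, ((M : ℂ) - r + y * Complex.I)⁻¹ := by simp only [e2]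
  have E4 : (∫ y : ℝ in -δ..δ, (((-M : ℝ) : ℂ) + y * Complex.I - r)⁻¹)
      = ∫ y : ℝ in -δ..δ, (((-M : ℝ) : ℂ) - r + y * Complex.I)⁻¹ := by simp only [e2]
  rw [rectInt, E1, E2, E3, E4, smul_eq_mul, smul_eq_mul]
  rw [one_mul] at bot top
  have c1 : (M : ℂ) + (((-δ : ℝ) : ℂ) * Complex.I - r) = M - r + ((-δ : ℝ) : ℂ) * Complex.I := by
    ring
  have c2 : (M : ℂ) + ((δ : ℂ) * Complex.I - r) = M - r + (δ : ℂ) * Complex.I := by ring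
  have c3 : ((-M : ℝ) : ℂ) + (((-δ : ℝ) : ℂ) * Complex.I - r)
      = ((-M : ℝ) : ℂ) - r + ((-δ : ℝ) : ℂ) * Complex.I := by ring
  have c4 : ((-M : ℝ) : ℂ) + ((δ : ℂ) * Complex.I - r)
      = ((-M : ℝ) : ℂ) - r + (δ : ℂ) * Complex.I := by ring
  rw [c1, c3] at bot
  rw [c2, c4] at top
  linear_combination bot - top + right - left + up + down

lemma integral_dslope {g : ℂ → ℂ} {z₀ : ℂ} {γ : ℝ → ℂ} {a b : ℝ} (hγ : Continuous γ)
    (hne : ∀ t ∈ uIcc a b, γ t ≠ z₀) (hg : ContinuousOn (fun t => g (γ t)) (uIcc a b)) :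
    ∫ t in a..b, dslope g z₀ (γ t)
      = (∫ t in a..b, g (γ t) * (γ t - z₀)⁻¹) - g z₀ * ∫ t in a..b, (γ t - z₀)⁻¹ := by
  have hinv : ContinuousOn (fun t => (γ t - z₀)⁻¹) (uIcc a b) :=
    (hγ.continuousOn.sub continuousOn_const).inv₀ fun t ht => sub_ne_zero.2 (hne t ht)
  have i1 : IntervalIntegrable (fun t => g (γ t) * (γ t - z₀)⁻¹) volume a b :=
    (hg.mul hinv).intervalIntegrable
  have i2 : IntervalIntegrable (fun t => g z₀ * (γ t - z₀)⁻¹) volume a b :=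
    (continuousOn_const.mul hinv).intervalIntegrable
  rw [← intervalIntegral.integral_const_mul, ← intervalIntegral.integral_sub i1 i2]
  refine intervalIntegral.integral_congr fun t ht => ?_
  rw [dslope_of_ne _ (hne t ht), slope_def_field, div_eq_mul_inv, sub_mul]

/-- Cauchy's integral formula on the boundary of a rectangle. -/
lemma rectInt_cauchy {M δ r : ℝ} (hδ : 0 < δ) (hr : |r| < M) {Q : Set ℂ} (hQ : IsOpen Q)
    (hsub : Icc (-M) M ×ℂ Icc (-δ) δ ⊆ Q) {g : ℂ → ℂ} (hg : DifferentiableOn ℂ g Q) :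
    rectInt M δ (fun ζ => g ζ * (ζ - r)⁻¹) = 2 * Real.pi * Complex.I * g r := by
  obtain ⟨h1, h2⟩ := abs_lt.1 hr
  have hM : -M ≤ M := by linarith
  have hδ' : -δ ≤ δ := by linarith
  have hrQ : (r : ℂ) ∈ Q := hsub (by
    rw [Complex.mem_reProdIm]
    simp [h1.le, h2.le, hδ.le])
  have hd : DifferentiableOn ℂ (dslope g r) Q :=
    (Complex.differentiableOn_dslope (hQ.mem_nhds hrQ)).2 hg
  have hz := Complex.integral_boundary_rect_eq_zero_of_differentiableOn (dslope g r)
    ⟨-M, -δ⟩ ⟨M, δ⟩ (hd.mono (by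
      simp only [uIcc_of_le hM, uIcc_of_le hδ']
      exact hsub))
  have horiz : ∀ c : ℝ, c ∈ Icc (-δ) δ → c ≠ 0 →
      ∫ x : ℝ in -M..M, dslope g r (x + c * Complex.I)
      = (∫ x : ℝ in -M..M, g (x + c * Complex.I) * (x + c * Complex.I - r)⁻¹)
        - g r * ∫ x : ℝ in -M..M, ((x : ℂ) + c * Complex.I - r)⁻¹ := by
    intro c hc hc0
    refine integral_dslope (γ := fun x : ℝ => (x : ℂ) + c * Complex.I) (by fun_prop) ?_ ?_
    · intro t _ h
      have := congrArg Complex.im h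
      simp at this
      exact hc0 this
    · refine hg.continuousOn.comp (by fun_prop) fun t ht => hsub ?_
      rw [uIcc_of_le hM] at ht
      rw [Complex.mem_reProdIm]
      simpa using ⟨ht, hc⟩
  have vert : ∀ c : ℝ, c ∈ Icc (-M) M → c ≠ r →
      ∫ y : ℝ in -δ..δ, dslope g r (c + y * Complex.I)
      = (∫ y : ℝ in -δ..δ, g (c + y * Complex.I) * (c + y * Complex.I - r)⁻¹)
        - g r * ∫ y : ℝ in -δ..δ, ((c : ℂ) + y * Complex.I - r)⁻¹ := by
    intro c hc hc0
    refine integral_dslope (γ := fun y : ℝ => (c : ℂ) + y * Complex.I) (by fun_prop) ?_ ?_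
    · intro t _ h
      have := congrArg Complex.re h
      simp at this
      exact hc0 this
    · refine hg.continuousOn.comp (by fun_prop) fun t ht => hsub ?_
      rw [uIcc_of_le hδ'] at ht
      rw [Complex.mem_reProdIm]
      simpa using ⟨hc, ht⟩
  simp only at hz
  rw [horiz (-δ) ⟨le_rfl, hδ'⟩ (by linarith), horiz δ ⟨hδ', le_rfl⟩ hδ.ne',
    vert M ⟨hM, le_rfl⟩ h2.ne', vert (-M) ⟨le_rfl, hM⟩ h1.ne] at hz
  have hi := rectInt_inv_sub hδ hr
  simp only [rectInt, smul_eq_mul] at hi hz ⊢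
  linear_combination hz + g r * hi

/-! ### Integrals of resolvents -/

section Resolvent

variable {A : Type*} [NormedRing A] [NormedAlgebra ℂ A] [CompleteSpace A]

/-- Integrals of resolvents against a bounded measurable curve are analytic. -/
lemma exists_analyticAt_resolvent_integral {a b : ℝ} (hab : a ≤ b) {ζ : ℝ → ℂ}
    (hζ : Continuous ζ) {c : ℝ → A} (hc : StronglyMeasurable c) {C : ℝ}
    (hC : ∀ t ∈ Icc a b, ‖c t‖ ≤ C) (v₀ : A)
    (hv₀ : ∀ t ∈ Icc a b, IsUnit (algebraMap ℂ A (ζ t) - v₀)) :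
    ∃ G : A → A, AnalyticAt ℂ G v₀ ∧
      ∀ v, (∀ t ∈ Icc a b, IsUnit (algebraMap ℂ A (ζ t) - v)) → ∀ L : A →L[ℂ] ℂ,
        L (G v) = ∫ t in a..b, L (c t * Ring.inverse (algebraMap ℂ A (ζ t) - v)) := by
  have h_int : ∀ g : C(Icc a b, A),
      IntervalIntegrable (fun t => c t * g (projIcc a b hab t)) volume a b := by
    intro g
    have hm : AEStronglyMeasurable (fun t => c t * g (projIcc a b hab t))
        (volume.restrict (uIoc a b)) :=
      (hc.mul (g.continuous.comp continuous_projIcc).stronglyMeasurable).aestronglyMeasurable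
    refine (intervalIntegrable_const (c := C * ‖g‖)).mono_fun hm ?_
    refine (ae_restrict_iff' measurableSet_uIoc).2 (Eventually.of_forall fun t ht => ?_)
    rw [uIoc_of_le hab] at ht
    have hCt := hC t (Ioc_subset_Icc_self ht)
    have hg := g.norm_coe_le_norm (projIcc a b hab t)
    calc ‖c t * g (projIcc a b hab t)‖ ≤ ‖c t‖ * ‖g (projIcc a b hab t)‖ := norm_mul_le _ _
      _ ≤ C * ‖g‖ := mul_le_mul hCt hg (norm_nonneg _) ((norm_nonneg _).trans hCt)
      _ ≤ ‖C * ‖g‖‖ := le_abs_self _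
  let T : C(Icc a b, A) →L[ℂ] A := LinearMap.mkContinuous
    { toFun := fun g => ∫ t in a..b, c t * g (projIcc a b hab t)
      map_add' := fun g h => by
        rw [← intervalIntegral.integral_add (h_int g) (h_int h)]
        simp only [ContinuousMap.add_apply, mul_add]
      map_smul' := fun k g => by
        rw [RingHom.id_apply, ← intervalIntegral.integral_smul]
        simp only [ContinuousMap.smul_apply, mul_smul_comm] } (C * |b - a|) fun g => by
    have h := intervalIntegral.norm_integral_le_of_norm_le_const (a := a) (b := b)
      (f := fun t => c t * g (projIcc a b hab t)) (C := C * ‖g‖) fun t ht => by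
        rw [uIoc_of_le hab] at ht
        have hCt := hC t (Ioc_subset_Icc_self ht)
        exact (norm_mul_le _ _).trans
          (mul_le_mul hCt (g.norm_coe_le_norm _) (norm_nonneg _) ((norm_nonneg _).trans hCt))
    exact h.trans_eq (by ring)
  let D : A →L[ℂ] C(Icc a b, A) := LinearMap.mkContinuous
    { toFun := fun v => ContinuousMap.const _ v
      map_add' := fun _ _ => rfl
      map_smul' := fun _ _ => rfl } 1 fun v => by
    rw [one_mul]
    exact (ContinuousMap.norm_le _ (norm_nonneg _)).2 fun _ => le_rfl
  let Z : C(Icc a b, A) := ⟨fun t => algebraMap ℂ A (ζ t),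
    (continuous_algebraMap ℂ A).comp (hζ.comp continuous_subtype_val)⟩
  have hunit : ∀ v, (∀ t ∈ Icc a b, IsUnit (algebraMap ℂ A (ζ t) - v)) → IsUnit (Z - D v) :=
    fun v hv => (ContinuousMap.isUnit_iff_forall_isUnit _).2 fun t => hv t t.2
  refine ⟨fun v => T (Ring.inverse (Z - D v)), ?_, fun v hv L => ?_⟩
  · have h1 : AnalyticAt ℂ (fun v => Z - D v) v₀ := analyticAt_const.sub (D.analyticAt v₀)
    have h2 : AnalyticAt ℂ Ring.inverse (Z - D v₀) := analyticAt_inverse (hunit v₀ hv₀).unit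
    have h3 : AnalyticAt ℂ (fun v => Ring.inverse (Z - D v)) v₀ :=
      AnalyticAt.comp (g := Ring.inverse) (f := fun v => Z - D v) h2 h1
    exact AnalyticAt.comp (g := T) (f := fun v => Ring.inverse (Z - D v)) (T.analyticAt _) h3
  · change L (∫ t in a..b, c t * Ring.inverse (Z - D v) (projIcc a b hab t)) = _
    rw [← L.intervalIntegral_comp_comm (h_int _)]
    refine intervalIntegral.integral_congr fun t ht => ?_
    rw [uIcc_of_le hab] at ht
    have hmul := congrArg (fun g : C(Icc a b, A) => g ⟨t, ht⟩)
      (Ring.mul_inverse_cancel _ (hunit v hv))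
    rw [projIcc_of_mem hab ht]
    congr 2
    have h3 : (algebraMap ℂ A (ζ t) - v) * Ring.inverse (Z - D v) ⟨t, ht⟩ = 1 := hmul
    rw [← one_mul (Ring.inverse (Z - D v) ⟨t, ht⟩), ← Ring.inverse_mul_cancel _ (hv t ht),
      mul_assoc, h3, mul_one]

end Resolvent

/-! ### Periodic functions and the Sobolev algebra -/

lemma zPeriodic_comp_proj {α : Type*} (g : UnitAddTorus (Fin d) → α) :
    ZPeriodic fun x => g (proj x) := by
  intro x i
  have h : proj (x + Pi.single i 1) = proj x := by
    funext j
    simp only [proj, Pi.add_apply]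
    by_cases hj : j = i
    · subst hj
      simp
    · simp [hj]
  simp only [h]

lemma ZPeriodic.eq_of_proj_eq {α : Type*} {u : (Fin d → ℝ) → α} (hu : ZPeriodic u)
    {x y : Fin d → ℝ} (h : proj x = proj y) : u x = u y := by
  have h1 : ∀ i, ∃ n : ℤ, x i = y i + n := fun i => by
    have h0 : ((x i - y i : ℝ) : UnitAddCircle) = 0 := by
      rw [AddCircle.coe_sub, sub_eq_zero]
      exact congrFun h i
    obtain ⟨n, hn⟩ := (AddCircle.coe_eq_zero_iff 1).1 h0
    exact ⟨n, by rw [zsmul_one] at hn; linarith⟩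
  choose n hn using h1
  have hx : x = y + ∑ i, Pi.single i (n i : ℝ) := by
    rw [Finset.univ_sum_single fun i => (n i : ℝ)]
    exact funext hn
  have hS : ∀ S : Finset (Fin d), u (y + ∑ i ∈ S, Pi.single i (n i : ℝ)) = u y := by
    intro S
    induction S using Finset.induction_on with
    | empty => simp
    | insert i S hi ih =>
      rw [Finset.sum_insert hi, add_comm (Pi.single i _), ← add_assoc, ← ih]
      have hp : Function.Periodic
          (fun t => u (y + ∑ i ∈ S, Pi.single i (n i : ℝ) + Pi.single i t)) 1 := fun t => by
        simp only [Pi.single_add, ← add_assoc]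
        exact hu _ i
      simpa using hp.int_mul_eq (n i)
  rw [hx, hS]

namespace HsAlg

variable {s : ℝ} [hs : Fact ((d : ℝ) / 2 < s)]

lemma ext_proj {a b : HsAlg d s} (h : ∀ x, toC a (proj x) = toC b (proj x)) : a = b := by
  refine toC_injective (ContinuousMap.ext fun y => ?_)
  obtain ⟨x, rfl⟩ := isOpenQuotientMap_proj.surjective y
  exact h x

lemma exists_toC_proj_eq {u : (Fin d → ℝ) → ℂ} (hu : MemHs s u) (hc : Continuous u) :
    ∃ a : HsAlg d s, ∀ x, toC a (proj x) = u x := by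
  let p : C(Fin d → ℝ, UnitAddTorus (Fin d)) := ⟨proj, isOpenQuotientMap_proj.continuous⟩
  have hp : Topology.IsQuotientMap p := isOpenQuotientMap_proj.isQuotientMap
  have hfac : Function.FactorsThrough (⟨u, hc⟩ : C(Fin d → ℝ, ℂ)) p := fun x y h =>
    ZPeriodic.eq_of_proj_eq hu.1 h
  let g := hp.lift _ hfac
  have hg : ∀ x, g (proj x) = u x := fun x =>
    DFunLike.congr_fun (hp.lift_comp _ hfac) x
  refine ⟨mk g ?_, hg⟩
  have h2 := hu.2
  rw [← funext hg] at h2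
  simp only [tcoeff_comp_proj] at h2
  exact h2

lemma memHs_toC (a : HsAlg d s) : MemHs s fun x => toC a (proj x) := by
  refine ⟨zPeriodic_comp_proj _, ?_⟩
  simpa only [tcoeff_comp_proj] using summable_weighted a

lemma continuous_toC_proj (a : HsAlg d s) : Continuous fun x => toC a (proj x) :=
  (toC a).continuous.comp isOpenQuotientMap_proj.continuous

lemma mFourierCoeff_star (u : C(UnitAddTorus (Fin d), ℂ)) (k : Fin d → ℤ) :
    mFourierCoeff (star u : C(UnitAddTorus (Fin d), ℂ)) k
      = starRingEnd ℂ (mFourierCoeff u (-k)) := by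
  unfold mFourierCoeff
  rw [← integral_conj]
  refine integral_congr_ae (Eventually.of_forall fun x => ?_)
  simp only [ContinuousMap.star_apply, smul_eq_mul, map_mul, ← mFourier_neg, neg_neg]
  rfl

lemma exists_conj (a : HsAlg d s) :
    ∃ b : HsAlg d s, (∀ x, toC b x = starRingEnd ℂ (toC a x)) ∧ ‖b‖ = ‖a‖ := by
  have hk : ∀ k, sobWeight s k * ‖mFourierCoeff (star (toC a) : C(UnitAddTorus (Fin d), ℂ)) k‖ ^ 2
      = sobWeight s (-k) * ‖mFourierCoeff (toC a) (-k)‖ ^ 2 := fun k => by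
    rw [mFourierCoeff_star, RCLike.norm_conj, sobWeight_neg]
  refine ⟨mk (star (toC a)) ?_, fun x => by rw [toC_mk]; rfl, ?_⟩
  · simp only [hk]
    exact (Equiv.neg (Fin d → ℤ)).summable_iff
      (f := fun k => sobWeight s k * ‖mFourierCoeff (toC a) k‖ ^ 2) |>.2 (summable_weighted a)
  · rw [← sq_eq_sq₀ (norm_nonneg _) (norm_nonneg _), norm_def, norm_def, norm_coef_sq,
      norm_coef_sq]
    simp only [toC_mk, hk]
    exact congrArg (nrm d s ^ 2 * ·) ((Equiv.neg (Fin d → ℤ)).tsum_eq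
      fun k => sobWeight s k * ‖mFourierCoeff (toC a) k‖ ^ 2)

/-- The real part acts on the Sobolev algebra without increasing the norm. -/
lemma exists_re (a : HsAlg d s) :
    ∃ b : HsAlg d s, (∀ x, toC b x = ((toC a x).re : ℂ)) ∧ ‖b‖ ≤ ‖a‖ := by
  obtain ⟨c, hc, hn⟩ := exists_conj a
  refine ⟨(2⁻¹ : ℂ) • (a + c), fun x => ?_, ?_⟩
  · rw [map_smul, map_add, ContinuousMap.smul_apply, ContinuousMap.add_apply, hc, Complex.add_conj,
      smul_eq_mul]
    push_cast
    ring
  · calc ‖(2⁻¹ : ℂ) • (a + c)‖ = 2⁻¹ * ‖a + c‖ := by rw [norm_smul]; simp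
      _ ≤ 2⁻¹ * (‖a‖ + ‖c‖) := by gcongr; exact norm_add_le _ _
      _ = ‖a‖ := by rw [hn]; ring

lemma norm_toC_apply_le (a : HsAlg d s) (x : UnitAddTorus (Fin d)) :
    ‖toC a x‖ ≤ ‖a‖ * ‖(1 : HsAlg d s)‖ :=
  AlgHom.norm_apply_le_self_mul_norm_one (eval x) a

/-! ### Measurability in the parameter -/

lemma stronglyMeasurable_of_coeff {X : Type*} [MeasurableSpace X] {Φ : X → HsAlg d s}
    (h : ∀ k, Measurable fun x => mFourierCoeff (toC (Φ x)) k) : StronglyMeasurable Φ := by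
  have hk : ∀ k, StronglyMeasurable fun x => mFourierCoeff (toC (Φ x)) k • mono (s := s) k :=
    fun k => (h k).stronglyMeasurable.smul_const _
  have hsum : ∀ S : Finset (Fin d → ℤ),
      StronglyMeasurable fun x => ∑ k ∈ S, mFourierCoeff (toC (Φ x)) k • mono (s := s) k :=
    fun S => Finset.stronglyMeasurable_fun_sum S fun k _ => hk k
  exact stronglyMeasurable_of_tendsto atTop hsum
    (tendsto_pi_nhds.2 fun x => hasSum_mono (Φ x))

end HsAlg

lemma continuousOn_tcoeff {Q : Set ℂ} (hQ : IsOpen Q) {f : (Fin d → ℝ) → ℂ → ℂ}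
    (hfc : ContinuousOn (fun p : (Fin d → ℝ) × ℂ => f p.1 p.2) (Set.univ ×ˢ Q)) (k : Fin d → ℤ) :
    ContinuousOn (fun z => tcoeff (fun x => f x z) k) Q := by
  rw [continuousOn_iff_continuous_domRestrict]
  have : LocallyCompactSpace Q := hQ.locallyCompactSpace
  simp only [tcoeff_eq_integral_Icc]
  refine continuous_parametric_integral_of_continuous (X := Q)
    (f := fun (z : Q) x => f x z * Complex.exp (-2 * Real.pi * Complex.I *
      (∑ i, (k i : ℂ) * (x i : ℂ)))) ?_ isCompact_Icc
  refine Continuous.mul ?_ ((continuous_expfac k).comp continuous_snd)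
  exact hfc.comp_continuous (f := fun p : Q × (Fin d → ℝ) => (p.2, (p.1 : ℂ))) (by fun_prop)
    fun p => ⟨mem_univ _, p.1.2⟩

/-- A function on the torus depending on a complex parameter, as a curve in the Sobolev algebra. -/
lemma exists_parameter_curve {s : ℝ} [hs : Fact ((d : ℝ) / 2 < s)] {Q : Set ℂ} (hQ : IsOpen Q)
    {f : (Fin d → ℝ) → ℂ → ℂ}
    (hfc : ContinuousOn (fun p : (Fin d → ℝ) × ℂ => f p.1 p.2) (Set.univ ×ˢ Q))
    (hfx : ∀ z ∈ Q, MemHs s (fun x => f x z) ∧ Continuous fun x => f x z) :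
    ∃ Φ : ℂ → HsAlg d s, StronglyMeasurable Φ ∧
      ∀ z ∈ Q, ∀ x, HsAlg.toC (Φ z) (proj x) = f x z := by
  classical
  have h : ∀ z, ∃ a : HsAlg d s, (z ∈ Q → ∀ x, HsAlg.toC a (proj x) = f x z) ∧
      (z ∉ Q → a = 0) := fun z => by
    by_cases hz : z ∈ Q
    · obtain ⟨a, ha⟩ := HsAlg.exists_toC_proj_eq (hfx z hz).1 (hfx z hz).2
      exact ⟨a, fun _ => ha, fun h => absurd hz h⟩
    · exact ⟨0, fun h => absurd h hz, fun _ => rfl⟩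
  choose Φ hΦ hΦ0 using h
  refine ⟨Φ, HsAlg.stronglyMeasurable_of_coeff fun k => ?_, hΦ⟩
  refine measurable_of_restrict_of_restrict_compl hQ.measurableSet ?_ ?_
  · have h1 := (continuousOn_iff_continuous_domRestrict.1 (continuousOn_tcoeff hQ hfc k)).measurable
    convert h1 using 1
    funext z
    simp only [Set.domRestrict_apply, ← tcoeff_comp_proj, hΦ z z.2]
  · convert measurable_const (a := (0 : ℂ)) using 1
    funext z
    simp only [Set.domRestrict_apply, hΦ0 z z.2]
    rw [map_zero]
    exact (coeffCLM k).map_zero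

/-! ### The composition operator -/

section Composition

open HsAlg

variable {s : ℝ} [hs : Fact ((d : ℝ) / 2 < s)] {f : (Fin d → ℝ) → ℂ → ℂ} {Φ : ℂ → HsAlg d s}

lemma exists_analyticAt_side (hΦm : StronglyMeasurable Φ) {K : Set ℂ}
    (hΦ : ∀ z ∈ K, ∀ x, toC (Φ z) (proj x) = f x z) {C : ℝ} (hC : ∀ z ∈ K, ‖Φ z‖ ≤ C)
    {M a b : ℝ} (hab : a ≤ b) {ζ : ℝ → ℂ} (hζ : Continuous ζ) (hζK : ∀ t ∈ Icc a b, ζ t ∈ K)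
    (hζM : ∀ t ∈ Icc a b, ∀ r : ℝ, |r| < M → ζ t ≠ r) {v₀ : HsAlg d s}
    (hv₀ : ∀ x, ∃ r : ℝ, |r| < M ∧ toC v₀ x = r) :
    ∃ G : HsAlg d s → HsAlg d s, AnalyticAt ℂ G v₀ ∧
      ∀ v, (∀ x, ∃ r : ℝ, |r| < M ∧ toC v x = r) → ∀ x,
        evalCLM (proj x) (G v) = ∫ t in a..b, f x (ζ t) * (ζ t - toC v (proj x))⁻¹ := by
  have hsub : ∀ (v : HsAlg d s) (t : ℝ) (x : UnitAddTorus (Fin d)),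
      toC (algebraMap ℂ (HsAlg d s) (ζ t) - v) x = ζ t - toC v x := fun v t x => by
    rw [map_sub, AlgHom.commutes]
    rfl
  have hunit : ∀ v : HsAlg d s, (∀ x, ∃ r : ℝ, |r| < M ∧ toC v x = r) →
      ∀ t ∈ Icc a b, IsUnit (algebraMap ℂ (HsAlg d s) (ζ t) - v) := fun v hv t ht => by
    refine isUnit_of_forall_ne_zero _ fun x => ?_
    obtain ⟨r, hr, hvr⟩ := hv x
    rw [hsub, hvr]
    exact sub_ne_zero.2 (hζM t ht r hr)
  obtain ⟨G, hG, hGv⟩ := exists_analyticAt_resolvent_integral hab hζ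
    (hΦm.comp_measurable hζ.measurable) (fun t ht => hC _ (hζK t ht)) v₀ (hunit v₀ hv₀)
  refine ⟨G, hG, fun v hv x => ?_⟩
  rw [hGv v (hunit v hv)]
  refine intervalIntegral.integral_congr fun t ht => ?_
  rw [uIcc_of_le hab] at ht
  change toC (Φ (ζ t) * _) (proj x) = _
  rw [map_mul, ContinuousMap.mul_apply, hΦ _ (hζK t ht), toC_inverse_apply (hunit v hv t ht), hsub]

/-- Near a real function the composition operator extends to an analytic map of the complex
Sobolev algebra. -/
lemma exists_analyticAt_composition (hΦm : StronglyMeasurable Φ) {Q : Set ℂ} (hQ : IsOpen Q)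
    (hQR : ∀ r : ℝ, (r : ℂ) ∈ Q) (hΦ : ∀ z ∈ Q, ∀ x, toC (Φ z) (proj x) = f x z)
    (hfan : ∀ x, AnalyticOnNhd ℂ (f x) Q)
    (hbd : ∀ R > (0 : ℝ), ∃ C : ℝ, ∀ z ∈ Q, ‖z‖ < R → ‖Φ z‖ ≤ C) {M : ℝ} (hM : 0 < M)
    {v₀ : HsAlg d s} (hv₀ : ∀ x, ∃ r : ℝ, |r| < M ∧ toC v₀ x = r) :
    ∃ G : HsAlg d s → HsAlg d s, AnalyticAt ℂ G v₀ ∧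
      ∀ v, (∀ x, ∃ r : ℝ, |r| < M ∧ toC v x = r) → ∀ x,
        toC (G v) (proj x) = f x (toC v (proj x)) := by
  have hK : IsCompact ((fun r : ℝ => (r : ℂ)) '' Icc (-M) M) :=
    isCompact_Icc.image Complex.continuous_ofReal
  obtain ⟨δ, hδ, hδQ⟩ := hK.exists_cthickening_subset_open hQ (by
    rintro _ ⟨r, _, rfl⟩
    exact hQR r)
  have hsub : Icc (-M) M ×ℂ Icc (-δ) δ ⊆ Q := fun z hz => by
    rw [Complex.mem_reProdIm] at hz
    refine hδQ (Metric.mem_cthickening_of_dist_le z (z.re : ℂ) δ _ ⟨z.re, hz.1, rfl⟩ ?_)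
    rw [dist_eq_norm]
    have : z - (z.re : ℂ) = z.im * Complex.I := by
      rw [sub_eq_iff_eq_add, add_comm, Complex.re_add_im]
    rw [this, norm_mul, Complex.norm_I, mul_one, Complex.norm_real]
    exact abs_le.2 hz.2
  obtain ⟨C, hC⟩ := hbd (M + δ + 1) (by linarith)
  have hCK : ∀ z ∈ Icc (-M) M ×ℂ Icc (-δ) δ, ‖Φ z‖ ≤ C := fun z hz => by
    refine hC z (hsub hz) ((Complex.norm_le_abs_re_add_abs_im z).trans_lt ?_)
    rw [Complex.mem_reProdIm] at hz
    linarith [abs_le.2 hz.1, abs_le.2 hz.2]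
  have hMM : -M ≤ M := by linarith
  have hδδ : -δ ≤ δ := by linarith
  have horiz : ∀ c : ℝ, c ∈ Icc (-δ) δ → c ≠ 0 →
      ∃ G : HsAlg d s → HsAlg d s, AnalyticAt ℂ G v₀ ∧
      ∀ v, (∀ x, ∃ r : ℝ, |r| < M ∧ toC v x = r) → ∀ x, evalCLM (proj x) (G v) =
        ∫ t : ℝ in -M..M, f x (t + c * Complex.I) * (t + c * Complex.I - toC v (proj x))⁻¹ := by
    intro c hc hc0
    refine exists_analyticAt_side hΦm (fun z hz => hΦ z (hsub hz)) hCK hMM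
      (ζ := fun t : ℝ => (t : ℂ) + c * Complex.I) (by fun_prop) (fun t ht => ?_)
      (fun t _ r _ h => ?_) hv₀
    · rw [Complex.mem_reProdIm]
      simpa using ⟨ht, hc⟩
    · have := congrArg Complex.im h
      simp at this
      exact hc0 this
  have vert : ∀ c : ℝ, |c| = M →
      ∃ G : HsAlg d s → HsAlg d s, AnalyticAt ℂ G v₀ ∧
      ∀ v, (∀ x, ∃ r : ℝ, |r| < M ∧ toC v x = r) → ∀ x, evalCLM (proj x) (G v) =
        ∫ t : ℝ in -δ..δ, f x (c + t * Complex.I) * (c + t * Complex.I - toC v (proj x))⁻¹ := by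
    intro c hc
    refine exists_analyticAt_side hΦm (fun z hz => hΦ z (hsub hz)) hCK hδδ
      (ζ := fun t : ℝ => (c : ℂ) + t * Complex.I) (by fun_prop) (fun t ht => ?_)
      (fun t _ r hr h => ?_) hv₀
    · rw [Complex.mem_reProdIm]
      simpa using ⟨abs_le.1 hc.le, ht⟩
    · have := congrArg Complex.re h
      simp at this
      rw [← this] at hr
      exact hr.ne hc
  obtain ⟨G₁, hG₁, e₁⟩ := horiz (-δ) ⟨le_rfl, hδδ⟩ (by linarith)
  obtain ⟨G₂, hG₂, e₂⟩ := horiz δ ⟨hδδ, le_rfl⟩ hδ.ne'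
  obtain ⟨G₃, hG₃, e₃⟩ := vert M (abs_of_pos hM)
  obtain ⟨G₄, hG₄, e₄⟩ := vert (-M) (by rw [abs_neg, abs_of_pos hM])
  refine ⟨fun v => (2 * Real.pi * Complex.I)⁻¹ •
    (G₁ v - G₂ v + Complex.I • G₃ v - Complex.I • G₄ v), ?_, fun v hv x => ?_⟩
  · have hI : ∀ G : HsAlg d s → HsAlg d s, AnalyticAt ℂ G v₀ → ∀ c : ℂ,
        AnalyticAt ℂ (fun v => c • G v) v₀ := fun G hG c => hG.fun_const_smul
    exact hI _ (((hG₁.fun_sub hG₂).fun_add (hI _ hG₃ _)).fun_sub (hI _ hG₄ _)) _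
  · obtain ⟨r, hr, hvr⟩ := hv (proj x)
    have h := rectInt_cauchy hδ hr hQ hsub (hfan x).differentiableOn
    rw [← evalCLM_apply, map_smul, map_sub, map_add, map_sub, map_smul, map_smul, e₁ v hv,
      e₂ v hv, e₃ v hv, e₄ v hv, hvr]
    rw [rectInt] at h
    rw [h, smul_eq_mul, inv_mul_cancel_left₀]
    exact Complex.two_pi_I_ne_zero

end Composition

section RealSpace

open HsAlg

variable {s : ℝ} [hs : Fact ((d : ℝ) / 2 < s)] {E : Type*} [NormedAddCommGroup E] [NormedSpace ℝ E]
  (toFun : E →ₗ[ℝ] ((Fin d → ℝ) → ℝ))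

lemma toC_real_smul (c : ℝ) (a : HsAlg d s) (x : UnitAddTorus (Fin d)) :
    toC (c • a) x = c * toC a x := by
  rw [← Complex.coe_smul, map_smul]
  rfl

/-- The complexification of the real Sobolev space. -/
lemma exists_embedding (hnorm : ∀ v : E, ‖v‖ = sobNormR s (toFun v))
    (hmem : ∀ v : E, MemHsR s (toFun v) ∧ Continuous (toFun v)) :
    ∃ ι : E →L[ℝ] HsAlg d s, ∀ v x, toC (ι v) (proj x) = toFun v x := by
  have h : ∀ v, ∃ a : HsAlg d s, ∀ x, toC a (proj x) = toFun v x := fun v =>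
    exists_toC_proj_eq (hmem v).1 (Complex.continuous_ofReal.comp (hmem v).2)
  choose ι hι using h
  refine ⟨LinearMap.mkContinuous
    { toFun := ι
      map_add' := fun v w => ext_proj fun x => ?_
      map_smul' := fun c v => ext_proj fun x => ?_ } (nrm d s) fun v => ?_, hι⟩
  · rw [hι, map_add, map_add, ContinuousMap.add_apply, hι, hι]
    simp
  · rw [hι, map_smul, RingHom.id_apply, toC_real_smul, hι]
    simp
  · change ‖ι v‖ ≤ _
    rw [norm_eq_sobNorm, funext (hι v), hnorm]
    rfl

/-- The projection onto the real Sobolev space. -/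
lemma exists_realPart (hinj : Function.Injective toFun)
    (hnorm : ∀ v : E, ‖v‖ = sobNormR s (toFun v))
    (hrange : ∀ u : (Fin d → ℝ) → ℝ, MemHsR s u → Continuous u → ∃ v : E, toFun v = u) :
    ∃ P : HsAlg d s →L[ℝ] E, ∀ a x, toFun (P a) x = (toC a (proj x)).re := by
  have h : ∀ a : HsAlg d s, ∃ v : E, (∀ x, toFun v x = (toC a (proj x)).re) ∧
      ‖v‖ ≤ (nrm d s)⁻¹ * ‖a‖ := fun a => by
    obtain ⟨b, hb, hba⟩ := exists_re a
    have hu : (fun x => toC b (proj x)) = fun x => ((toC a (proj x)).re : ℂ) :=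
      funext fun x => hb _
    have hm := memHs_toC b
    rw [hu] at hm
    obtain ⟨v, hv⟩ := hrange (fun x => (toC a (proj x)).re) hm
      (Complex.continuous_re.comp (continuous_toC_proj a))
    refine ⟨v, congrFun hv, ?_⟩
    rw [norm_eq_sobNorm, hu] at hba
    rw [hnorm, hv, ← div_eq_inv_mul, le_div_iff₀' nrm_pos]
    exact hba
  choose P hP hn using h
  refine ⟨LinearMap.mkContinuous
    { toFun := P
      map_add' := fun a b => hinj (funext fun x => ?_)
      map_smul' := fun c a => hinj (funext fun x => ?_) } _ hn, hP⟩
  · rw [hP, map_add, map_add, Pi.add_apply, hP, hP]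
    simp
  · rw [hP, toC_real_smul, map_smul, Pi.smul_apply, hP]
    simp

end RealSpace

end HsTorus

end

/-- real Nemytskii operator is real-analytic.
`E` is a real Banach space realizing `H^s(𝕋^d;ℝ)`, `s > d/2`. If `f(x,u)` is as in the
composition-operator setting (continuous on `𝕋^d × Q` with `Q ⊇ ℝ` open in `ℂ`,
analytic in `u`, `H^s`-smooth in `x`, with `‖f(·,u)‖_s ≤ C(R)` for `|u| < R`) and `f`
is real for real arguments, then `u ↦ f(·, u(·))` defines a real-analytic map
`H^s(𝕋^d;ℝ) → H^s(𝕋^d;ℝ)`. -/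
theorem stmt7 {d : ℕ} (hd : 1 ≤ d) (s : ℝ) (hs : s > d / 2)
    {E : Type*} [NormedAddCommGroup E] [NormedSpace ℝ E] [CompleteSpace E]
    (toFun : E →ₗ[ℝ] ((Fin d → ℝ) → ℝ))
    (hinj : Function.Injective toFun)
    (hnorm : ∀ v : E, ‖v‖ = sobNormR s (toFun v))
    (hmem : ∀ v : E, MemHsR s (toFun v) ∧ Continuous (toFun v))
    (hrange : ∀ u : (Fin d → ℝ) → ℝ, MemHsR s u → Continuous u → ∃ v : E, toFun v = u)
    (Q : Set ℂ) (hQ : IsOpen Q) (hQR : ∀ r : ℝ, (r : ℂ) ∈ Q)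
    (f : (Fin d → ℝ) → ℂ → ℂ)
    (hfc : ContinuousOn (fun p : (Fin d → ℝ) × ℂ => f p.1 p.2) (Set.univ ×ˢ Q))
    (hfper : ∀ z ∈ Q, ZPeriodic fun x => f x z)
    (hfan : ∀ x : Fin d → ℝ, AnalyticOnNhd ℂ (f x) Q)
    (hfx : ∀ z ∈ Q, MemHs s (fun x => f x z) ∧ Continuous fun x => f x z)
    (hbd : ∀ R > (0 : ℝ), ∃ C : ℝ, ∀ z ∈ Q, ‖z‖ < R → sobNorm s (fun x => f x z) ≤ C)
    (hreal : ∀ (x : Fin d → ℝ) (r : ℝ), (f x (r : ℂ)).im = 0) :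
    ∃ F : E → E,
      (∀ (v : E) (x : Fin d → ℝ), toFun (F v) x = (f x ((toFun v x : ℝ) : ℂ)).re) ∧
      AnalyticOnNhd ℝ F Set.univ := by
  have : Fact ((d : ℝ) / 2 < s) := ⟨hs⟩
  obtain ⟨Φ, hΦm, hΦ⟩ := HsTorus.exists_parameter_curve (s := s) hQ hfc hfx
  obtain ⟨ι, hι⟩ := HsTorus.exists_embedding (s := s) toFun hnorm hmem
  obtain ⟨P, hP⟩ := HsTorus.exists_realPart (s := s) toFun hinj hnorm hrange
  have hbdΦ : ∀ R > (0 : ℝ), ∃ C : ℝ, ∀ z ∈ Q, ‖z‖ < R → ‖Φ z‖ ≤ C := fun R hR => by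
    obtain ⟨C, hC⟩ := hbd R hR
    refine ⟨HsTorus.HsAlg.nrm d s * C, fun z hz hzR => ?_⟩
    rw [HsTorus.HsAlg.norm_eq_sobNorm, funext (hΦ z hz)]
    exact mul_le_mul_of_nonneg_left (hC z hz hzR) HsTorus.HsAlg.nrm_pos.le
  set N : ℝ := ‖(1 : HsTorus.HsAlg d s)‖
  have hgood : ∀ (M : ℝ) (v : E), ‖ι v‖ * N < M →
      ∀ y, ∃ r : ℝ, |r| < M ∧ HsTorus.HsAlg.toC (ι v) y = r := fun M v hv y => by
    obtain ⟨x, rfl⟩ := HsTorus.isOpenQuotientMap_proj.surjective y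
    refine ⟨toFun v x, ?_, hι v x⟩
    have h := HsTorus.HsAlg.norm_toC_apply_le (ι v) (HsTorus.proj x)
    rw [hι, Complex.norm_real] at h
    exact h.trans_lt hv
  have hloc : ∀ v₀ : E, ∃ H : E → E, AnalyticAt ℝ H v₀ ∧ ∀ᶠ v in nhds v₀, ∀ x,
      toFun (H v) x = (f x ((toFun v x : ℝ) : ℂ)).re := fun v₀ => by
    have hlt : ‖ι v₀‖ * N < ‖ι v₀‖ * N + 1 := lt_add_one _
    obtain ⟨G, hG, hGv⟩ := HsTorus.exists_analyticAt_composition hΦm hQ hQR hΦ hfan hbdΦ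
      (by positivity) (hgood _ v₀ hlt)
    have h1 : AnalyticAt ℝ (fun v => G (ι v)) v₀ :=
      AnalyticAt.comp (g := G) (f := ι) hG.restrictScalars (ι.analyticAt v₀)
    refine ⟨fun v => P (G (ι v)),
      AnalyticAt.comp (g := P) (f := fun v => G (ι v)) (P.analyticAt _) h1, ?_⟩
    have hcont : Continuous fun v => ‖ι v‖ * N := by fun_prop
    filter_upwards [hcont.continuousAt.eventually_lt continuousAt_const hlt] with v hv x
    rw [hP, hGv _ (hgood _ v hv), hι]
  choose H hH hHv using hloc
  refine ⟨fun v => H v v, fun v x => (hHv v).self_of_nhds x, fun v₀ _ => ?_⟩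
  refine (hH v₀).congr ?_
  filter_upwards [hHv v₀] with v hv
  refine hinj (funext fun x => ?_)
  rw [hv, (hHv v).self_of_nhds]
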